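/- Let w = w_1 ⋯ w_n be a permutation of {1,…,n}, and let w_i ⋯ w_j and w_{i'} ⋯ w_{j'} each be a maximal k-ascending section or a maximal k-descending section of w. If j < i', then there is a k-up or a k-down in w_j ⋯ w_{i'}; that is, there exist indices j ≤ s < t ≤ i' with |w_s - w_t| ≥ k. -/

import Mathlib

open Nat

/-- `ι` enumerates (the positions of) an alternating subsequence of `w`:
positions are strictly increasing and the values satisfy `w_{i₁} > w_{i₂} < w_{i₃} > ⋯`. -/
def IsAltSeq {n : ℕ} (w : Equiv.Perm (Fin n)) {s : ℕ} (ι : Fin s → Fin n) : Prop :=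
  StrictMono ι ∧
    ∀ (j : ℕ) (hj : j + 1 < s),
      if j % 2 = 0 then
        (w (ι ⟨j + 1, hj⟩) : ℕ) < (w (ι ⟨j, Nat.lt_of_succ_lt hj⟩) : ℕ)
      else
        (w (ι ⟨j, Nat.lt_of_succ_lt hj⟩) : ℕ) < (w (ι ⟨j + 1, hj⟩) : ℕ)

/-- `ι` enumerates a reverse alternating subsequence of `w`:
`w_{i₁} < w_{i₂} > w_{i₃} < ⋯`. -/
def IsRevAltSeq {n : ℕ} (w : Equiv.Perm (Fin n)) {s : ℕ} (ι : Fin s → Fin n) : Prop :=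
  StrictMono ι ∧
    ∀ (j : ℕ) (hj : j + 1 < s),
      if j % 2 = 0 then
        (w (ι ⟨j, Nat.lt_of_succ_lt hj⟩) : ℕ) < (w (ι ⟨j + 1, hj⟩) : ℕ)
      else
        (w (ι ⟨j + 1, hj⟩) : ℕ) < (w (ι ⟨j, Nat.lt_of_succ_lt hj⟩) : ℕ)

/-- Each pair of neighbouring entries of the subsequence differs by at least `k`
in absolute value. -/
def HasGaps (k : ℕ) {n : ℕ} (w : Equiv.Perm (Fin n)) {s : ℕ} (ι : Fin s → Fin n) : Prop :=
  ∀ (j : ℕ) (hj : j + 1 < s),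
    (k : ℤ) ≤ |((w (ι ⟨j, Nat.lt_of_succ_lt hj⟩) : ℕ) : ℤ) -
               ((w (ι ⟨j + 1, hj⟩) : ℕ) : ℤ)|

/-- `as_k(w)`: the maximal length of a `k`-alternating subsequence of `w`. -/
noncomputable def kAltLen (n k : ℕ) (w : Equiv.Perm (Fin n)) : ℕ :=
  sSup {s : ℕ | ∃ ι : Fin s → Fin n, IsAltSeq w ι ∧ HasGaps k w ι}

/-- The maximal length of a `k`-reverse-alternating subsequence of `w`. -/
noncomputable def kRevAltLen (n k : ℕ) (w : Equiv.Perm (Fin n)) : ℕ :=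
  sSup {s : ℕ | ∃ ι : Fin s → Fin n, IsRevAltSeq w ι ∧ HasGaps k w ι}

/-- `zs_k(w)`: the maximal length of a `k`-zigzagging subsequence of `w`. -/
noncomputable def kZigLen (n k : ℕ) (w : Equiv.Perm (Fin n)) : ℕ :=
  sSup {s : ℕ | ∃ ι : Fin s → Fin n, (IsAltSeq w ι ∨ IsRevAltSeq w ι) ∧ HasGaps k w ι}

/-- The section `w_s ⋯ w_t` is a `k`-up: `s < t` and `w_t - w_s ≥ k`. -/
def IsKUp (k : ℕ) {n : ℕ} (w : Equiv.Perm (Fin n)) (s t : Fin n) : Prop :=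
  s < t ∧ (w s : ℕ) + k ≤ (w t : ℕ)

/-- The section `w_s ⋯ w_t` is a `k`-down: `s < t` and `w_s - w_t ≥ k`. -/
def IsKDown (k : ℕ) {n : ℕ} (w : Equiv.Perm (Fin n)) (s t : Fin n) : Prop :=
  s < t ∧ (w t : ℕ) + k ≤ (w s : ℕ)

/-- The section `w_i ⋯ w_j` is `k`-ascending: `w_i` is its minimum, `w_j` its maximum,
`w_j - w_i ≥ k`, and there is no `k`-down inside it. -/
def IsKAsc (k : ℕ) {n : ℕ} (w : Equiv.Perm (Fin n)) (i j : Fin n) : Prop :=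
  i < j ∧
  (∀ t : Fin n, i ≤ t → t ≤ j → (w i : ℕ) ≤ (w t : ℕ) ∧ (w t : ℕ) ≤ (w j : ℕ)) ∧
  (w i : ℕ) + k ≤ (w j : ℕ) ∧
  ∀ s t : Fin n, i ≤ s → t ≤ j → ¬ IsKDown k w s t

/-- The section `w_i ⋯ w_j` is `k`-descending: `w_i` is its maximum, `w_j` its minimum,
`w_i - w_j ≥ k`, and there is no `k`-up inside it. -/
def IsKDesc (k : ℕ) {n : ℕ} (w : Equiv.Perm (Fin n)) (i j : Fin n) : Prop :=
  i < j ∧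
  (∀ t : Fin n, i ≤ t → t ≤ j → (w t : ℕ) ≤ (w i : ℕ) ∧ (w j : ℕ) ≤ (w t : ℕ)) ∧
  (w j : ℕ) + k ≤ (w i : ℕ) ∧
  ∀ s t : Fin n, i ≤ s → t ≤ j → ¬ IsKUp k w s t

/-- `w_i ⋯ w_j` is a maximal `k`-ascending section: it is `k`-ascending and it is not
contained in any other `k`-ascending section. -/
def IsMaxKAsc (k : ℕ) {n : ℕ} (w : Equiv.Perm (Fin n)) (i j : Fin n) : Prop :=
  IsKAsc k w i j ∧ ∀ i' j' : Fin n, IsKAsc k w i' j' → i' ≤ i → j ≤ j' → i' = i ∧ j' = j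

/-- `w_i ⋯ w_j` is a maximal `k`-descending section. -/
def IsMaxKDesc (k : ℕ) {n : ℕ} (w : Equiv.Perm (Fin n)) (i j : Fin n) : Prop :=
  IsKDesc k w i j ∧ ∀ i' j' : Fin n, IsKDesc k w i' j' → i' ≤ i → j ≤ j' → i' = i ∧ j' = j

/-- `w_p` is a `k`-peak of `w`: `p` is the right end of a maximal `k`-ascending section
or the left end of a maximal `k`-descending section. -/
def IsKPeakPos (k : ℕ) {n : ℕ} (w : Equiv.Perm (Fin n)) (p : Fin n) : Prop :=
  (∃ i, IsMaxKAsc k w i p) ∨ (∃ j, IsMaxKDesc k w p j)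

/-- `w_p` is a `k`-valley of `w`: `p` is the left end of a maximal `k`-ascending section
or the right end of a maximal `k`-descending section. -/
def IsKValleyPos (k : ℕ) {n : ℕ} (w : Equiv.Perm (Fin n)) (p : Fin n) : Prop :=
  (∃ j, IsMaxKAsc k w p j) ∨ (∃ i, IsMaxKDesc k w i p)

/-- Complementing the values of `w` exchanges `k`-ups and `k`-downs. -/
theorem isKUp_trans_revPerm {k n : ℕ} {w : Equiv.Perm (Fin n)} {s t : Fin n} :
    IsKUp k (w.trans Fin.revPerm) s t ↔ IsKDown k w s t := by
  simp only [IsKUp, IsKDown, Equiv.trans_apply, Fin.revPerm_apply, Fin.val_rev]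
  have := (w s).isLt
  have := (w t).isLt
  constructor <;> rintro ⟨h, h'⟩ <;> exact ⟨h, by omega⟩

theorem isKDown_trans_revPerm {k n : ℕ} {w : Equiv.Perm (Fin n)} {s t : Fin n} :
    IsKDown k (w.trans Fin.revPerm) s t ↔ IsKUp k w s t := by
  simp only [IsKUp, IsKDown, Equiv.trans_apply, Fin.revPerm_apply, Fin.val_rev]
  have := (w s).isLt
  have := (w t).isLt
  constructor <;> rintro ⟨h, h'⟩ <;> exact ⟨h, by omega⟩

theorem isKAsc_trans_revPerm {k n : ℕ} {w : Equiv.Perm (Fin n)} {i j : Fin n} :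
    IsKAsc k (w.trans Fin.revPerm) i j ↔ IsKDesc k w i j := by
  simp only [IsKAsc, IsKDesc, isKDown_trans_revPerm, Equiv.trans_apply, Fin.revPerm_apply,
    Fin.val_rev]
  have := (w i).isLt
  have := (w j).isLt
  constructor <;> rintro ⟨h, h₁, h₂, h₃⟩ <;>
    refine ⟨h, fun t ht ht' ↦ ?_, by omega, h₃⟩ <;>
    have := h₁ t ht ht' <;> have := (w t).isLt <;> omega

theorem isKDesc_trans_revPerm {k n : ℕ} {w : Equiv.Perm (Fin n)} {i j : Fin n} :
    IsKDesc k (w.trans Fin.revPerm) i j ↔ IsKAsc k w i j := by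
  rw [← isKAsc_trans_revPerm]
  have : (w.trans Fin.revPerm).trans Fin.revPerm = w := by
    ext; simp
  rw [this]

theorem isMaxKAsc_trans_revPerm {k n : ℕ} {w : Equiv.Perm (Fin n)} {i j : Fin n} :
    IsMaxKAsc k (w.trans Fin.revPerm) i j ↔ IsMaxKDesc k w i j := by
  simp only [IsMaxKAsc, IsMaxKDesc, isKAsc_trans_revPerm]

theorem isMaxKDesc_trans_revPerm {k n : ℕ} {w : Equiv.Perm (Fin n)} {i j : Fin n} :
    IsMaxKDesc k (w.trans Fin.revPerm) i j ↔ IsMaxKAsc k w i j := by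
  simp only [IsMaxKAsc, IsMaxKDesc, isKDesc_trans_revPerm]

/-- A section with no `k`-up or `k`-down starting at the end of a `k`-ascending section extends
that section up to the maximum of the former. -/
theorem IsKAsc.extend_right {k n : ℕ} {w : Equiv.Perm (Fin n)} {i j m : Fin n}
    (h : IsKAsc k w i j) (hjm : j ≤ m)
    (hgap : ∀ s t : Fin n, j ≤ s → t ≤ m → ¬ IsKUp k w s t ∧ ¬ IsKDown k w s t)
    (hmax : ∀ t : Fin n, j ≤ t → t ≤ m → (w t : ℕ) ≤ (w m : ℕ)) : IsKAsc k w i m := by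
  obtain ⟨hij, hmm, hk, hdown⟩ := h
  have hjm' := hmax j le_rfl hjm
  refine ⟨hij.trans_le hjm, fun t hit htm ↦ ?_, by omega, fun s t his htm hst ↦ ?_⟩
  · rcases le_or_gt t j with htj | hjt
    · have := hmm t hit htj
      omega
    · have := hmax t hjt.le htm
      have := (hgap j t le_rfl htm).2
      simp only [IsKDown, hjt, true_and] at this
      omega
  · rcases le_or_gt t j with htj | hjt
    · exact hdown s t his htj hst
    · rcases le_or_gt s j with hsj | hjs
      · have := hmm s his hsj
        refine (hgap j t le_rfl htm).2 ⟨hjt, ?_⟩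
        have := hst.2
        omega
      · exact (hgap s t hjs.le htm).2 hst

/-- A section with no `k`-up or `k`-down ending at the start of a `k`-descending section extends
that section back to the maximum of the former. -/
theorem IsKDesc.extend_left {k n : ℕ} {w : Equiv.Perm (Fin n)} {i j m : Fin n}
    (h : IsKDesc k w i j) (hmi : m ≤ i)
    (hgap : ∀ s t : Fin n, m ≤ s → t ≤ i → ¬ IsKUp k w s t ∧ ¬ IsKDown k w s t)
    (hmax : ∀ t : Fin n, m ≤ t → t ≤ i → (w t : ℕ) ≤ (w m : ℕ)) : IsKDesc k w m j := by
  obtain ⟨hij, hmm, hk, hup⟩ := h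
  have hmi' := hmax i hmi le_rfl
  refine ⟨hmi.trans_lt hij, fun t hmt htj ↦ ?_, by omega, fun s t hms htj hst ↦ ?_⟩
  · rcases le_or_gt i t with hit | hti
    · have := hmm t hit htj
      omega
    · have := hmax t hmt hti.le
      have := (hgap t i hmt le_rfl).1
      simp only [IsKUp, hti, true_and] at this
      omega
  · rcases le_or_gt i s with his | hsi
    · exact hup s t his htj hst
    · rcases le_or_gt i t with hit | hti
      · have := hmm t hit htj
        refine (hgap s i hms le_rfl).1 ⟨hsi, ?_⟩
        have := hst.2
        omega
      · exact (hgap s t hms hti.le).1 hst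

theorem IsMaxKAsc.exists_kUp_or_kDown_of_isMaxKDesc {k n : ℕ} {w : Equiv.Perm (Fin n)}
    {i j i' j' : Fin n} (h1 : IsMaxKAsc k w i j) (h2 : IsMaxKDesc k w i' j') (hji' : j < i') :
    ∃ s t : Fin n, j ≤ s ∧ t ≤ i' ∧ (IsKUp k w s t ∨ IsKDown k w s t) := by
  by_contra! hgap
  obtain ⟨m, hm, hmax⟩ := Finset.exists_max_image (Finset.Icc j i') (fun t ↦ (w t : ℕ))
    ⟨j, Finset.mem_Icc.2 ⟨le_rfl, hji'.le⟩⟩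
  simp only [Finset.mem_Icc] at hm hmax
  have hmj := (h1.2 i m (h1.1.extend_right hm.1 (fun s t hs ht ↦ hgap s t hs (ht.trans hm.2))
    fun t ht ht' ↦ hmax t ⟨ht, ht'.trans hm.2⟩) le_rfl hm.1).2
  have hmi' := (h2.2 m j' (h2.1.extend_left hm.2 (fun s t hs ht ↦ hgap s t (hm.1.trans hs) ht)
    fun t ht ht' ↦ hmax t ⟨hm.1.trans ht, ht'⟩) hm.2 le_rfl).1
  exact hji'.ne (hmj.symm.trans hmi')

/-- A section without a `k`-down is `k`-ascending between the positions of its minimum and its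
maximum, provided these differ by at least `k`. -/
theorem isKAsc_of_forall_not_isKDown {k n : ℕ} {w : Equiv.Perm (Fin n)} {i j a b : Fin n}
    (hk : 0 < k) (hdown : ∀ s t : Fin n, i ≤ s → t ≤ j → ¬ IsKDown k w s t)
    (ha : i ≤ a ∧ a ≤ j) (hb : i ≤ b ∧ b ≤ j)
    (hmin : ∀ t : Fin n, i ≤ t ∧ t ≤ j → (w a : ℕ) ≤ (w t : ℕ))
    (hmax : ∀ t : Fin n, i ≤ t ∧ t ≤ j → (w t : ℕ) ≤ (w b : ℕ))
    (hab : (w a : ℕ) + k ≤ (w b : ℕ)) : IsKAsc k w a b := by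
  refine ⟨?_, fun t ht ht' ↦ ?_, hab, fun s t hs ht ↦ hdown s t (ha.1.trans hs) (ht.trans hb.2)⟩
  · rcases lt_trichotomy a b with h | h | h
    · exact h
    · subst h
      omega
    · exact absurd ⟨h, hab⟩ (hdown b a hb.1 ha.2)
  · exact ⟨hmin t ⟨ha.1.trans ht, ht'.trans hb.2⟩, hmax t ⟨ha.1.trans ht, ht'.trans hb.2⟩⟩

theorem IsMaxKAsc.exists_kUp_or_kDown_of_isMaxKAsc {k n : ℕ} {w : Equiv.Perm (Fin n)}
    {i j i' j' : Fin n} (hk : 0 < k) (h1 : IsMaxKAsc k w i j) (h2 : IsMaxKAsc k w i' j')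
    (hji' : j < i') :
    ∃ s t : Fin n, j ≤ s ∧ t ≤ i' ∧ (IsKUp k w s t ∨ IsKDown k w s t) := by
  by_contra! hgap
  obtain ⟨⟨hij, hmm, hk1, hd⟩, hM⟩ := h1
  obtain ⟨⟨hij', hmm', hk1', hd'⟩, hM'⟩ := h2
  have hjd : ∀ t, j < t → t ≤ i' → (w j : ℕ) < w t + k := fun t h h' ↦ by
    have := (hgap j t le_rfl h').2
    simp only [IsKDown, h, true_and] at this
    omega
  have hid : ∀ s, j ≤ s → s < i' → (w s : ℕ) < w i' + k := fun s h h' ↦ by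
    have := (hgap s i' h le_rfl).2
    simp only [IsKDown, h', true_and] at this
    omega
  have hji := hjd i' hji' le_rfl
  have hdown : ∀ s t : Fin n, i ≤ s → t ≤ j' → ¬ IsKDown k w s t := by
    rintro s t his htj' ⟨hst, hlt⟩
    rcases le_or_gt t j with htj | hjt
    · exact hd s t his htj ⟨hst, hlt⟩
    rcases le_or_gt i' s with his' | hsi'
    · exact hd' s t his' htj' ⟨hst, hlt⟩
    rcases le_or_gt s j with hsj | hjs
    · have := hmm s his hsj
      rcases le_or_gt i' t with hit | hti
      · have := hmm' t hit htj'
        omega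
      · have := hjd t hjt hti.le
        omega
    · rcases le_or_gt i' t with hit | hti
      · have := hmm' t hit htj'
        have := hid s hjs.le hsi'
        omega
      · exact (hgap s t hjs.le hti.le).2 ⟨hst, hlt⟩
  have hne : (Finset.Icc i j').Nonempty :=
    ⟨j, Finset.mem_Icc.2 ⟨hij.le, (hji'.trans hij').le⟩⟩
  obtain ⟨a, ha, hmin⟩ := Finset.exists_min_image _ (fun t ↦ (w t : ℕ)) hne
  obtain ⟨b, hb, hmax⟩ := Finset.exists_max_image _ (fun t ↦ (w t : ℕ)) hne
  simp only [Finset.mem_Icc] at ha hmin hb hmax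
  have hai := hmin i ⟨le_rfl, ha.1.trans ha.2⟩
  have hai' := hmin i' ⟨(hij.trans hji').le, hij'.le⟩
  have hbj := hmax j ⟨hij.le, (hji'.trans hij').le⟩
  have hbj' := hmax j' ⟨ha.1.trans ha.2, le_rfl⟩
  have hasc : IsKAsc k w a b :=
    isKAsc_of_forall_not_isKDown hk hdown ha hb hmin hmax (by omega)
  have hinj : ∀ s t : Fin n, (w s : ℕ) = w t → s = t := fun s t h ↦ w.injective (Fin.ext h)
  rcases le_or_gt a j with haj | hja
  · obtain rfl : a = i := hinj a i (le_antisymm hai (hmm a ha.1 haj).1)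
    have hb_eq : b = j := by
      rcases le_or_gt j b with h | h
      · exact (hM a b hasc le_rfl h).2
      · exact hinj b j (le_antisymm (hmm b hb.1 h.le).2 hbj)
    subst hb_eq
    omega
  · rcases le_or_gt b i' with hbi | hib
    · exact (hgap a b hja.le hbi).1 ⟨hasc.1, hasc.2.2.1⟩
    · obtain rfl : b = j' := hinj b j' (le_antisymm (hmm' b hib.le hb.2).2 hbj')
      have ha_eq : a = i' := by
        rcases le_or_gt a i' with h | h
        · exact (hM' a b hasc h le_rfl).1
        · exact hinj a i' (le_antisymm hai' (hmm' a h.le ha.2).1)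
      subst ha_eq
      omega

/-- Between two maximal sections (each maximal `k`-ascending or maximal `k`-descending),
with the first one ending at `j` before the second one starting at `i'`, there is a
`k`-up or a `k`-down in `w_j ⋯ w_{i'}`. -/
theorem kUp_or_kDown_between_maximal_sections (n k : ℕ) (hk : 2 ≤ k + 1) (hkn : k + 1 ≤ n)
    (w : Equiv.Perm (Fin n)) (i j i' j' : Fin n)
    (h1 : IsMaxKAsc k w i j ∨ IsMaxKDesc k w i j)
    (h2 : IsMaxKAsc k w i' j' ∨ IsMaxKDesc k w i' j')
    (hji' : j < i') :
    ∃ s t : Fin n, j ≤ s ∧ t ≤ i' ∧ (IsKUp k w s t ∨ IsKDown k w s t) := by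
  have hk' : 0 < k := by omega
  rcases h1 with h1 | h1
  · rcases h2 with h2 | h2
    · exact h1.exists_kUp_or_kDown_of_isMaxKAsc hk' h2 hji'
    · exact h1.exists_kUp_or_kDown_of_isMaxKDesc h2 hji'
  · rw [← isMaxKAsc_trans_revPerm] at h1
    have key : ∃ s t : Fin n, j ≤ s ∧ t ≤ i' ∧
        (IsKUp k (w.trans Fin.revPerm) s t ∨ IsKDown k (w.trans Fin.revPerm) s t) := by
      rcases h2 with h2 | h2
      · exact h1.exists_kUp_or_kDown_of_isMaxKDesc (isMaxKDesc_trans_revPerm.2 h2) hji'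
      · exact h1.exists_kUp_or_kDown_of_isMaxKAsc hk' (isMaxKAsc_trans_revPerm.2 h2) hji'
    simpa only [isKUp_trans_revPerm, isKDown_trans_revPerm, or_comm] using key
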